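/- Let p_u denote the centered Gaussian density on ℝ^d with covariance u·a (a positive definite), and let T_u φ(x) = ∫ φ(y) p_u(y − x) dy be the heat semigroup generated by A = (1/2)Σ_{i,j} a_{ij} ∂_i∂_j. Then for Schwartz functions φ, ψ and s, t ≥ 0, ∫_0^{min(s,t)} ∫_{ℝ^d} Σ_{i,j} a_{ij} ∂_i(T_{t−u}φ)(x) ∂_j(T_{s−u}ψ)(x) dx du = ∫∫ φ(y)ψ(z) p_{|t−s|}(z−y) dz dy − ∫∫ φ(y)ψ(z) p_{t+s}(z−y) dz dy. -/

import Mathlib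

open MeasureTheory Real Matrix

/-- The centered Gaussian density on `ℝ^d` with covariance matrix `u • a`. -/
noncomputable def gaussDensity (d : ℕ) (a : Matrix (Fin d) (Fin d) ℝ) (u : ℝ)
    (x : Fin d → ℝ) : ℝ :=
  (2 * π * u) ^ (-(d : ℝ) / 2) * (a.det) ^ (-(1 : ℝ) / 2) *
    Real.exp (-(1 / (2 * u)) * (x ⬝ᵥ a⁻¹.mulVec x))

/-- `∫∫ φ(y) ψ(z) p_u(z-y) dz dy`, with `p_0` interpreted as the Dirac mass,
so that the value at `u = 0` is `∫ φ ψ`. -/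
noncomputable def gaussPairing (d : ℕ) (a : Matrix (Fin d) (Fin d) ℝ) (u : ℝ)
    (φ ψ : (Fin d → ℝ) → ℝ) : ℝ :=
  if u = 0 then ∫ x : Fin d → ℝ, φ x * ψ x
  else ∫ y : Fin d → ℝ, ∫ z : Fin d → ℝ, φ y * ψ z * gaussDensity d a u (z - y)


/-- The Gaussian heat semigroup `T_u φ(x) = ∫ φ(y) p_u(y−x) dy`, with `T_0 = id`. -/
noncomputable def heatSemigroup (d : ℕ) (a : Matrix (Fin d) (Fin d) ℝ) (u : ℝ)
    (φ : (Fin d → ℝ) → ℝ) (x : Fin d → ℝ) : ℝ :=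
  if u = 0 then φ x else ∫ y : Fin d → ℝ, φ y * gaussDensity d a u (y - x)

/-- Partial derivative `∂_i f`. -/
noncomputable def pderiv' (d : ℕ) (i : Fin d) (f : (Fin d → ℝ) → ℝ)
    (x : Fin d → ℝ) : ℝ :=
  fderiv ℝ f x (Pi.single i 1)

open SchwartzMap FourierTransform LineDeriv
open scoped ContDiff InnerProductSpace

section HeatFlow

variable {V : Type*} [NormedAddCommGroup V]

/-- The Fourier symbol of the standard heat semigroup at time `u`. -/
noncomputable def heatSymbol (u : ℝ) (ξ : V) : ℝ := Real.exp (-(2 * π ^ 2 * u * ‖ξ‖ ^ 2))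

theorem heatSymbol_mul (u v : ℝ) (ξ : V) :
    heatSymbol u ξ * heatSymbol v ξ = heatSymbol (u + v) ξ := by
  rw [heatSymbol, heatSymbol, heatSymbol, ← Real.exp_add]
  ring_nf

theorem norm_ofReal_heatSymbol_le_one {u : ℝ} (hu : 0 ≤ u) (ξ : V) :
    ‖(heatSymbol u ξ : ℂ)‖ ≤ 1 := by
  have : 0 ≤ 2 * π ^ 2 * u * ‖ξ‖ ^ 2 := by positivity
  rw [Complex.norm_real, heatSymbol, Real.norm_eq_abs, Real.abs_exp, Real.exp_le_one_iff]
  linarith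

theorem integral_Ioc_heatSymbol {s t : ℝ} (hs : 0 ≤ s) (ht : 0 ≤ t) (ξ : V) :
    ∫ u in Set.Ioc 0 (min s t), 4 * π ^ 2 * ‖ξ‖ ^ 2 * heatSymbol (t - u + (s - u)) ξ =
      heatSymbol |t - s| ξ - heatSymbol (t + s) ξ := by
  have hd (u : ℝ) : HasDerivAt (fun u ↦ heatSymbol (t - u + (s - u)) ξ)
      (4 * π ^ 2 * ‖ξ‖ ^ 2 * heatSymbol (t - u + (s - u)) ξ) u := by
    have h1 : HasDerivAt (fun u : ℝ ↦ -(2 * π ^ 2 * (t - u + (s - u)) * ‖ξ‖ ^ 2))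
        (-(2 * π ^ 2 * (-1 + -1) * ‖ξ‖ ^ 2)) u :=
      (((((hasDerivAt_id u).const_sub t).add ((hasDerivAt_id u).const_sub s)).const_mul
        (2 * π ^ 2)).mul_const _).neg
    convert! h1.exp using 1
    simp only [heatSymbol]
    ring
  have hc : Continuous fun u ↦ 4 * π ^ 2 * ‖ξ‖ ^ 2 * heatSymbol (t - u + (s - u)) ξ := by
    unfold heatSymbol
    fun_prop
  rw [← intervalIntegral.integral_of_le (le_min hs ht),
    intervalIntegral.integral_eq_sub_of_hasDerivAt (fun u _ ↦ hd u) (hc.intervalIntegrable _ _)]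
  congr 2
  · rcases le_total s t with h | h
    · rw [min_eq_left h, abs_of_nonneg (by linarith)]; ring
    · rw [min_eq_right h, abs_of_nonpos (by linarith)]; ring
  · ring

variable [InnerProductSpace ℝ V]

theorem heatSymbol_hasTemperateGrowth {u : ℝ} (hu : 0 ≤ u) :
    (heatSymbol u : V → ℝ).HasTemperateGrowth := by
  have hf : (fun ξ : V ↦ -(2 * π ^ 2 * u * ‖ξ‖ ^ 2)).HasTemperateGrowth :=
    ((Function.HasTemperateGrowth.const (2 * π ^ 2 * u)).mul
      (Function.hasTemperateGrowth_norm_sq V)).neg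
  refine Function.HasTemperateGrowth.comp' (g := Real.exp) (t := Set.Iic 0) ?_ (uniqueDiffOn_Iic 0)
    Real.contDiff_exp.contDiffOn (fun N ↦ ⟨0, 1, zero_le_one, fun n _ x hx ↦ ?_⟩) hf
  · rintro _ ⟨ξ, rfl⟩
    have : 0 ≤ 2 * π ^ 2 * u * ‖ξ‖ ^ 2 := by positivity
    simpa using this
  · rw [norm_iteratedFDerivWithin_eq_norm_iteratedDerivWithin,
      iteratedDerivWithin_eq_iteratedDeriv (uniqueDiffOn_Iic 0) Real.contDiff_exp.contDiffAt hx,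
      iteratedDeriv_eq_iterate, Real.iter_deriv_exp]
    simpa using hx

variable [FiniteDimensional ℝ V] [MeasurableSpace V] [BorelSpace V]

/-- The standard Gaussian density with covariance `u • 1` on a Euclidean space. -/
noncomputable def stdGaussDensity (u : ℝ) (x : V) : ℝ :=
  (2 * π * u) ^ (-(Module.finrank ℝ V : ℝ) / 2) * Real.exp (-(1 / (2 * u)) * ‖x‖ ^ 2)

/-- The standard heat semigroup on a Euclidean space, with the identity at time `0`. -/
noncomputable def heatFlow (u : ℝ) (f : V → ℝ) (x : V) : ℝ :=
  if u = 0 then f x else ∫ y, f y * stdGaussDensity u (y - x)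

/-- The standard heat semigroup on complex Schwartz functions, as a Fourier multiplier. -/
noncomputable def heatMultiplier (u : ℝ) (F : 𝓢(V, ℂ)) : 𝓢(V, ℂ) :=
  fourierMultiplierCLM ℂ (heatSymbol u) F

theorem fourier_heatMultiplier {u : ℝ} (hu : 0 ≤ u) (F : 𝓢(V, ℂ)) (ξ : V) :
    𝓕 (heatMultiplier u F) ξ = heatSymbol u ξ * 𝓕 F ξ := by
  rw [heatMultiplier, fourierMultiplierCLM_apply, FourierTransform.fourier_fourierInv_eq,
    smulLeftCLM_apply_apply (heatSymbol_hasTemperateGrowth hu)]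
  simp

theorem heatMultiplier_zero (F : 𝓢(V, ℂ)) : heatMultiplier 0 F = F := by
  have : (heatSymbol 0 : V → ℝ) = fun _ ↦ 1 := by ext; simp [heatSymbol]
  rw [heatMultiplier, this, fourierMultiplierCLM_const]
  simp

theorem stdGaussDensity_eq_fourier {u : ℝ} (hu : 0 < u) (x w : V) :
    (stdGaussDensity u (w - x) : ℂ) =
      𝓕 (fun v : V ↦ Complex.exp (-((2 * π ^ 2 * u : ℝ) : ℂ) * ‖v‖ ^ 2
        + 2 * π * Complex.I * ⟪x, v⟫_ℝ)) w := by
  have hb : 0 < 2 * π ^ 2 * u := by positivity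
  rw [fourier_gaussian_innerProductSpace' (by rwa [Complex.ofReal_re]), stdGaussDensity]
  have h1 : (π : ℂ) / ((2 * π ^ 2 * u : ℝ) : ℂ) = (((2 * π * u)⁻¹ : ℝ) : ℂ) := by
    push_cast
    field_simp [Real.pi_ne_zero]
  have h2 : -(1 / (2 * u)) * ‖w - x‖ ^ 2 = -π ^ 2 * ‖x - w‖ ^ 2 / (2 * π ^ 2 * u) := by
    rw [norm_sub_rev]
    field_simp
  have h3 : ((Module.finrank ℝ V : ℂ) / 2) = (((Module.finrank ℝ V : ℝ) / 2 : ℝ) : ℂ) := by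
    push_cast; rfl
  rw [h1, h2, h3, ← Complex.ofReal_cpow (by positivity), Real.inv_rpow (by positivity),
    ← Real.rpow_neg (by positivity), neg_div]
  push_cast
  rfl

theorem ofReal_heatFlow {u : ℝ} (hu : 0 ≤ u) (f : 𝓢(V, ℝ)) (x : V) :
    (heatFlow u f x : ℂ) = heatMultiplier u (f.postcompCLM Complex.ofRealCLM) x := by
  rcases hu.eq_or_lt with rfl | hu
  · simp [heatFlow, heatMultiplier_zero]
  set F : 𝓢(V, ℂ) := f.postcompCLM Complex.ofRealCLM
  set G : V → ℂ := fun v : V ↦ Complex.exp (-((2 * π ^ 2 * u : ℝ) : ℂ) * ‖v‖ ^ 2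
        + 2 * π * Complex.I * ⟪x, v⟫_ℝ)
  have hb : 0 < 2 * π ^ 2 * u := by positivity
  have hG : Integrable G := GaussianFourier.integrable_cexp_neg_mul_sq_norm_add
    (by rwa [Complex.ofReal_re]) _ x
  have key : ∫ ξ, 𝓕 F ξ * G ξ = ∫ y, F y * 𝓕 G y := by
    simpa using! VectorFourier.integral_bilin_fourierIntegral_eq_flip (.mul ℂ ℂ) (L := innerₗ V)
      continuous_fourierChar continuous_inner F.integrable hG
  rw [heatFlow, if_neg hu.ne', ← integral_complex_ofReal, heatMultiplier,
    fourierMultiplierCLM_apply, fourierInv_coe, Real.fourierInv_eq']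
  calc _ = ∫ y, F y * 𝓕 G y := by
        congr with y
        rw [Complex.ofReal_mul, stdGaussDensity_eq_fourier hu]
        rfl
    _ = _ := by
        rw [← key]
        congr with ξ
        rw [smulLeftCLM_apply_apply (heatSymbol_hasTemperateGrowth hu.le)]
        simp only [G, heatSymbol, Complex.real_smul, smul_eq_mul, Complex.exp_add,
          Complex.ofReal_exp, real_inner_comm x]
        push_cast
        ring_nf

theorem fourier_lineDeriv_heatMultiplier {u : ℝ} (hu : 0 ≤ u) (F : 𝓢(V, ℂ)) (v ξ : V) :
    𝓕 (∂_{v} (heatMultiplier u F)) ξ =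
      2 * π * Complex.I * ⟪ξ, v⟫_ℝ * (heatSymbol u ξ * 𝓕 F ξ) := by
  rw [fourier_lineDerivOp_eq, _root_.smul_apply, smulLeftCLM_apply_apply (by fun_prop),
    fourier_heatMultiplier hu]
  simp
  ring

theorem differentiable_heatFlow {u : ℝ} (hu : 0 ≤ u) (f : 𝓢(V, ℝ)) :
    Differentiable ℝ (heatFlow u f) := by
  have : heatFlow u f = fun x ↦
      Complex.reCLM (heatMultiplier u (f.postcompCLM Complex.ofRealCLM) x) := by
    ext x
    rw [← ofReal_heatFlow hu]
    simp
  rw [this]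
  exact Complex.reCLM.differentiable.comp (SchwartzMap.differentiable _)

theorem ofReal_fderiv_heatFlow {u : ℝ} (hu : 0 ≤ u) (f : 𝓢(V, ℝ)) (x v : V) :
    (fderiv ℝ (heatFlow u f) x v : ℂ) =
      ∂_{v} (heatMultiplier u (f.postcompCLM Complex.ofRealCLM)) x := by
  have h : ⇑(heatMultiplier u (f.postcompCLM Complex.ofRealCLM)) =
      fun x ↦ Complex.ofRealCLM (heatFlow u f x) := by
    ext x
    simp [ofReal_heatFlow hu]
  rw [lineDerivOp_apply_eq_fderiv, h]
  have := (Complex.ofRealCLM.hasFDerivAt.comp x (differentiable_heatFlow hu f x).hasFDerivAt).fderiv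
  exact (DFunLike.congr_fun this v).symm

/-- The inner product of a function with its image under the heat semigroup, in Fourier space. -/
theorem ofReal_integral_mul_heatFlow {u : ℝ} (hu : 0 ≤ u) (f g : 𝓢(V, ℝ)) :
    ((∫ x, f x * heatFlow u g x : ℝ) : ℂ) =
      ∫ ξ : V, (heatSymbol u ξ : ℂ) * ⟪𝓕 (f.postcompCLM Complex.ofRealCLM) ξ,
        𝓕 (g.postcompCLM Complex.ofRealCLM) ξ⟫_ℂ := by
  rw [← integral_complex_ofReal]
  calc _ = ∫ x, ⟪f.postcompCLM Complex.ofRealCLM x,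
        heatMultiplier u (g.postcompCLM Complex.ofRealCLM) x⟫_ℂ := by
        congr with x
        rw [← ofReal_heatFlow hu]
        simp [mul_comm]
    _ = _ := by
        rw [← integral_inner_fourier_fourier]
        congr with ξ
        rw [fourier_heatMultiplier hu]
        simp
        ring

theorem SchwartzMap.integrable_norm_mul_norm (A B : 𝓢(V, ℂ)) :
    Integrable fun x ↦ ‖A x‖ * ‖B x‖ :=
  (A.memLp 2).norm.integrable_mul (B.memLp 2).norm

theorem SchwartzMap.integrable_inner (A B : 𝓢(V, ℂ)) : Integrable fun x ↦ ⟪A x, B x⟫_ℂ :=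
  (A.integrable_norm_mul_norm B).mono' (A.continuous.inner B.continuous).aestronglyMeasurable
    (.of_forall fun _ ↦ norm_inner_le_norm _ _)

theorem ofReal_integral_sum_fderiv_heatFlow {ι : Type*} [Fintype ι] (b : OrthonormalBasis ι ℝ V)
    {u v : ℝ} (hu : 0 ≤ u) (hv : 0 ≤ v) (f g : 𝓢(V, ℝ)) :
    ((∫ x, ∑ k, fderiv ℝ (heatFlow u f) x (b k) * fderiv ℝ (heatFlow v g) x (b k) : ℝ) : ℂ) =
      ∫ ξ : V, ((4 * π ^ 2 * ‖ξ‖ ^ 2 * heatSymbol (u + v) ξ : ℝ) : ℂ) *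
        ⟪𝓕 (f.postcompCLM Complex.ofRealCLM) ξ, 𝓕 (g.postcompCLM Complex.ofRealCLM) ξ⟫_ℂ := by
  set F : 𝓢(V, ℂ) := f.postcompCLM Complex.ofRealCLM
  set G : 𝓢(V, ℂ) := g.postcompCLM Complex.ofRealCLM
  rw [← integral_complex_ofReal]
  calc _ = ∫ x, ∑ k, ⟪(∂_{b k} (heatMultiplier u F)) x, (∂_{b k} (heatMultiplier v G)) x⟫_ℂ := by
        congr with x
        push_cast
        refine Finset.sum_congr rfl fun k _ ↦ ?_
        rw [← ofReal_fderiv_heatFlow hu, ← ofReal_fderiv_heatFlow hv]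
        simp [mul_comm]
    _ = ∑ k, ∫ ξ, ⟪𝓕 (∂_{b k} (heatMultiplier u F)) ξ, 𝓕 (∂_{b k} (heatMultiplier v G)) ξ⟫_ℂ := by
        rw [integral_finsetSum _ fun k _ ↦ SchwartzMap.integrable_inner _ _]
        simp_rw [integral_inner_fourier_fourier]
    _ = _ := by
        rw [← integral_finsetSum _ fun k _ ↦ SchwartzMap.integrable_inner _ _]
        congr with ξ
        have hnorm : ∑ k, (⟪ξ, b k⟫_ℝ : ℂ) ^ 2 = (‖ξ‖ : ℂ) ^ 2 := by
          exact_mod_cast (b.sum_sq_inner_left ξ)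
        simp_rw [fourier_lineDeriv_heatMultiplier hu, fourier_lineDeriv_heatMultiplier hv,
          ← heatSymbol_mul]
        calc _ = ∑ k, (⟪ξ, b k⟫_ℝ : ℂ) ^ 2 * (4 * π ^ 2 * (heatSymbol u ξ * heatSymbol v ξ) *
              ⟪𝓕 F ξ, 𝓕 G ξ⟫_ℂ) := by
              refine Finset.sum_congr rfl fun k _ ↦ ?_
              simp [Complex.conj_ofNat]
              linear_combination (-4) * π ^ 2 * (⟪ξ, b k⟫_ℝ : ℂ) ^ 2 * heatSymbol u ξ *
                heatSymbol v ξ * 𝓕 G ξ * (starRingEnd ℂ) (𝓕 F ξ) * Complex.I_sq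
          _ = _ := by
              rw [← Finset.sum_mul, hnorm]
              push_cast
              ring

/-- The covariance identity for the standard heat semigroup on a Euclidean space. -/
theorem integral_integral_sum_fderiv_heatFlow {ι : Type*} [Fintype ι] (b : OrthonormalBasis ι ℝ V)
    {s t : ℝ} (hs : 0 ≤ s) (ht : 0 ≤ t) (f g : 𝓢(V, ℝ)) :
    ∫ u in Set.Ioc 0 (min s t), ∫ x, ∑ k,
        fderiv ℝ (heatFlow (t - u) f) x (b k) * fderiv ℝ (heatFlow (s - u) g) x (b k) =
      (∫ x, f x * heatFlow |t - s| g x) - ∫ x, f x * heatFlow (t + s) g x := by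
  set P : V → ℂ := fun ξ ↦ ⟪𝓕 (f.postcompCLM Complex.ofRealCLM) ξ,
    𝓕 (g.postcompCLM Complex.ofRealCLM) ξ⟫_ℂ
  have hPc : Continuous P := (SchwartzMap.continuous _).inner (SchwartzMap.continuous _)
  have hPint : Integrable P := SchwartzMap.integrable_inner _ _
  have hPint2 : Integrable fun ξ ↦ 4 * π ^ 2 * ‖ξ‖ ^ 2 * ‖P ξ‖ := by
    have hg : (fun ξ : V ↦ 4 * π ^ 2 * ‖ξ‖ ^ 2).HasTemperateGrowth :=
      (Function.HasTemperateGrowth.const _).mul (Function.hasTemperateGrowth_norm_sq V)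
    refine (SchwartzMap.integrable_norm_mul_norm
      (smulLeftCLM ℂ (fun ξ : V ↦ 4 * π ^ 2 * ‖ξ‖ ^ 2) (𝓕 (f.postcompCLM Complex.ofRealCLM)))
      (𝓕 (g.postcompCLM Complex.ofRealCLM))).mono' (by fun_prop) (.of_forall fun ξ ↦ ?_)
    have h0 : 0 ≤ 4 * π ^ 2 * ‖ξ‖ ^ 2 := by positivity
    rw [smulLeftCLM_apply_apply hg, norm_smul, Real.norm_of_nonneg h0, norm_mul, norm_norm,
      Real.norm_of_nonneg h0, mul_assoc (4 * π ^ 2 * ‖ξ‖ ^ 2)]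
    exact mul_le_mul_of_nonneg_left (norm_inner_le_norm (𝕜 := ℂ) (E := ℂ) _ _) h0
  have hsymb_int {u : ℝ} (hu : 0 ≤ u) : Integrable fun ξ ↦ (heatSymbol u ξ : ℂ) * P ξ :=
    hPint.bdd_mul (c := 1) (by unfold heatSymbol; fun_prop)
      (.of_forall (norm_ofReal_heatSymbol_le_one hu))
  rw [← Complex.ofReal_inj, Complex.ofReal_sub, ofReal_integral_mul_heatFlow (abs_nonneg _),
    ofReal_integral_mul_heatFlow (add_nonneg ht hs), ← integral_complex_ofReal,
    ← integral_sub (hsymb_int (abs_nonneg _)) (hsymb_int (add_nonneg ht hs))]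
  calc _ = ∫ u in Set.Ioc 0 (min s t), ∫ ξ : V,
        ((4 * π ^ 2 * ‖ξ‖ ^ 2 * heatSymbol (t - u + (s - u)) ξ : ℝ) : ℂ) * P ξ := by
        refine setIntegral_congr_fun measurableSet_Ioc fun u hu ↦ ?_
        have := hu.2
        exact ofReal_integral_sum_fderiv_heatFlow b (by linarith [min_le_right s t])
          (by linarith [min_le_left s t]) f g
    _ = ∫ ξ : V, ∫ u in Set.Ioc 0 (min s t),
        ((4 * π ^ 2 * ‖ξ‖ ^ 2 * heatSymbol (t - u + (s - u)) ξ : ℝ) : ℂ) * P ξ := by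
        apply integral_integral_swap
        have hbound : Integrable (fun p : ℝ × V ↦ 4 * π ^ 2 * ‖p.2‖ ^ 2 * ‖P p.2‖)
            ((volume.restrict (Set.Ioc 0 (min s t))).prod volume) := hPint2.comp_snd _
        refine hbound.mono' ?_ ?_
        · refine Continuous.aestronglyMeasurable ?_
          unfold heatSymbol
          fun_prop
        · have hmem : ∀ᵐ u ∂volume.restrict (Set.Ioc 0 (min s t)), u ∈ Set.Ioc 0 (min s t) :=
            ae_restrict_mem measurableSet_Ioc
          filter_upwards [Measure.quasiMeasurePreserving_fst.ae hmem] with ⟨u, ξ⟩ hu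
          have hu2 := hu.2
          have hnonneg : 0 ≤ t - u + (s - u) := by
            linarith [min_le_right s t, min_le_left s t]
          have h0 : 0 ≤ 4 * π ^ 2 * ‖ξ‖ ^ 2 := by positivity
          have h1 := norm_ofReal_heatSymbol_le_one hnonneg ξ
          simp only [Function.uncurry]
          rw [Complex.ofReal_mul, norm_mul, norm_mul, Complex.norm_of_nonneg h0]
          exact mul_le_mul_of_nonneg_right (mul_le_of_le_one_right h0 h1) (norm_nonneg _)
    _ = _ := by
        congr with ξ
        rw [integral_mul_const, integral_complex_ofReal, integral_Ioc_heatSymbol hs ht]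
        push_cast
        ring

end HeatFlow

section Whitening

variable {d : ℕ}

/-- The linear change of variables `y ↦ S y` from Euclidean space to coordinate space. -/
noncomputable def mulVecEquiv (S : Matrix (Fin d) (Fin d) ℝ) (hS : IsUnit S.det) :
    EuclideanSpace ℝ (Fin d) ≃L[ℝ] (Fin d → ℝ) :=
  (EuclideanSpace.equiv (Fin d) ℝ).trans
    (S.toLinearEquiv' (S.invertibleOfIsUnitDet hS)).toContinuousLinearEquiv

variable {S : Matrix (Fin d) (Fin d) ℝ} (hS : IsUnit S.det)

theorem mulVecEquiv_apply (y : EuclideanSpace ℝ (Fin d)) :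
    mulVecEquiv S hS y = S *ᵥ y.ofLp := rfl

theorem integral_eq_abs_det_mul_integral_comp_mulVecEquiv (F : (Fin d → ℝ) → ℝ) :
    ∫ x, F x = |S.det| * ∫ y, F (mulVecEquiv S hS y) := by
  have h1 : ∫ y, F (mulVecEquiv S hS y) = ∫ x : Fin d → ℝ, F (Matrix.toLin' S x) :=
    (PiLp.volume_preserving_ofLp (Fin d)).integral_comp
      (MeasurableEquiv.toLp 2 (Fin d → ℝ)).symm.measurableEmbedding
      (fun x ↦ F (Matrix.toLin' S x))
  have h2 : MeasurableEmbedding (Matrix.toLin' S) :=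
    (S.toLinearEquiv' (S.invertibleOfIsUnitDet hS)).toContinuousLinearEquiv.toHomeomorph
      |>.measurableEmbedding
  rw [h1, ← h2.integral_map, Real.map_matrix_volume_pi_eq_smul_volume_pi hS.ne_zero,
    integral_smul_measure, ENNReal.toReal_ofReal (abs_nonneg _), abs_inv, smul_eq_mul,
    mul_inv_cancel_left₀ (abs_ne_zero.2 hS.ne_zero)]

theorem gaussDensity_mulVecEquiv {u : ℝ} (w : EuclideanSpace ℝ (Fin d)) :
    gaussDensity d (S * Sᵀ) u (mulVecEquiv S hS w) = |S.det|⁻¹ * stdGaussDensity u w := by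
  have hq : mulVecEquiv S hS w ⬝ᵥ (S * Sᵀ)⁻¹ *ᵥ mulVecEquiv S hS w = ‖w‖ ^ 2 := by
    have hST : IsUnit Sᵀ.det := by rwa [Matrix.det_transpose]
    rw [mulVecEquiv_apply, Matrix.mul_inv_rev, Matrix.mulVec_mulVec,
      Matrix.nonsing_inv_mul_cancel_right _ _ hS, Matrix.dotProduct_mulVec, ← Matrix.mulVec_transpose,
      Matrix.mulVec_mulVec, Matrix.transpose_nonsing_inv, Matrix.transpose_transpose,
      Matrix.nonsing_inv_mul _ hS, Matrix.one_mulVec, EuclideanSpace.norm_sq_eq]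
    simp [dotProduct, sq]
  have hdet : (S * Sᵀ).det ^ (-(1 : ℝ) / 2) = |S.det|⁻¹ := by
    rw [Matrix.det_mul, Matrix.det_transpose, neg_div, Real.rpow_neg (mul_self_nonneg _),
      ← Real.sqrt_eq_rpow, Real.sqrt_mul_self_eq_abs]
  rw [gaussDensity, hq, hdet, stdGaussDensity, finrank_euclideanSpace_fin]
  ring

theorem heatSemigroup_mulVecEquiv (u : ℝ) (φ : (Fin d → ℝ) → ℝ) (x : EuclideanSpace ℝ (Fin d)) :
    heatSemigroup d (S * Sᵀ) u φ (mulVecEquiv S hS x) = heatFlow u (φ ∘ mulVecEquiv S hS) x := by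
  unfold heatSemigroup heatFlow
  split_ifs with hu
  · rfl
  · rw [integral_eq_abs_det_mul_integral_comp_mulVecEquiv hS, ← integral_const_mul]
    congr with y
    rw [← map_sub, gaussDensity_mulVecEquiv, Function.comp_apply]
    field_simp [abs_ne_zero.2 hS.ne_zero]

theorem gaussPairing_eq_integral_mul_heatSemigroup (a : Matrix (Fin d) (Fin d) ℝ) (u : ℝ)
    (φ ψ : (Fin d → ℝ) → ℝ) :
    gaussPairing d a u φ ψ = ∫ x, φ x * heatSemigroup d a u ψ x := by
  unfold gaussPairing heatSemigroup
  split_ifs with hu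
  · rfl
  · simp_rw [← integral_const_mul, mul_assoc]

theorem gaussPairing_eq_abs_det_mul (u : ℝ) (φ ψ : (Fin d → ℝ) → ℝ) :
    gaussPairing d (S * Sᵀ) u φ ψ = |S.det| * ∫ x, (φ ∘ mulVecEquiv S hS) x *
      heatFlow u (ψ ∘ mulVecEquiv S hS) x := by
  rw [gaussPairing_eq_integral_mul_heatSemigroup,
    integral_eq_abs_det_mul_integral_comp_mulVecEquiv hS]
  simp_rw [heatSemigroup_mulVecEquiv, Function.comp_apply]

theorem fderiv_comp_mulVecEquiv (F : (Fin d → ℝ) → ℝ) (x : EuclideanSpace ℝ (Fin d)) (k : Fin d) :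
    fderiv ℝ (F ∘ mulVecEquiv S hS) x (EuclideanSpace.basisFun (Fin d) ℝ k) =
      ∑ i, S i k * pderiv' d i F (mulVecEquiv S hS x) := by
  have hcol : mulVecEquiv S hS (EuclideanSpace.basisFun (Fin d) ℝ k) =
      ∑ i, S i k • Pi.single i (1 : ℝ) := by
    ext j
    simp [mulVecEquiv_apply, Pi.single_apply]
  rw [ContinuousLinearEquiv.comp_right_fderiv, ContinuousLinearMap.comp_apply,
    ContinuousLinearEquiv.coe_coe, hcol, map_sum]
  simp [pderiv']

theorem sum_sum_mul_pderiv_mulVecEquiv (F G : (Fin d → ℝ) → ℝ) (x : EuclideanSpace ℝ (Fin d)) :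
    ∑ i, ∑ j, (S * Sᵀ) i j * pderiv' d i F (mulVecEquiv S hS x) *
        pderiv' d j G (mulVecEquiv S hS x) =
      ∑ k, fderiv ℝ (F ∘ mulVecEquiv S hS) x (EuclideanSpace.basisFun (Fin d) ℝ k) *
        fderiv ℝ (G ∘ mulVecEquiv S hS) x (EuclideanSpace.basisFun (Fin d) ℝ k) := by
  simp_rw [fderiv_comp_mulVecEquiv, Finset.sum_mul_sum, Matrix.mul_apply, Matrix.transpose_apply,
    Finset.sum_mul]
  rw [Finset.sum_comm_cycle]
  refine Finset.sum_congr rfl fun k _ ↦ Finset.sum_congr rfl fun i _ ↦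
    Finset.sum_congr rfl fun j _ ↦ ?_
  ring

open scoped MatrixOrder Matrix.Norms.L2Operator in
theorem Matrix.PosDef.exists_eq_mul_transpose {a : Matrix (Fin d) (Fin d) ℝ} (ha : a.PosDef) :
    ∃ S : Matrix (Fin d) (Fin d) ℝ, IsUnit S.det ∧ a = S * Sᵀ := by
  obtain ⟨B, rfl⟩ := CStarAlgebra.nonneg_iff_eq_star_mul_self.1 ha.posSemidef.nonneg
  have h := ha.det_pos.ne'
  rw [Matrix.det_mul] at h
  refine ⟨Bᵀ, ?_, ?_⟩
  · rw [Matrix.det_transpose]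
    exact (right_ne_zero_of_mul h).isUnit
  · rw [Matrix.star_eq_conjTranspose, Matrix.conjTranspose_eq_transpose_of_trivial,
      Matrix.transpose_transpose]

end Whitening

/-- Covariance identity for the generalized Ornstein–Uhlenbeck integral:
`∫_0^{s∧t} ∫ Σ a_{ij} ∂_i(T_{t−u}φ) ∂_j(T_{s−u}ψ) dx du
  = ∫∫ φψ p_{|t−s|} − ∫∫ φψ p_{t+s}`. -/
theorem ou_covariance_identity (d : ℕ) (a : Matrix (Fin d) (Fin d) ℝ)
    (ha : a.PosDef) (haSymm : a.IsSymm) (s t : ℝ) (hs : 0 ≤ s) (ht : 0 ≤ t)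
    (φ ψ : SchwartzMap (Fin d → ℝ) ℝ) :
    (∫ u in Set.Ioc (0 : ℝ) (min s t), ∫ x : Fin d → ℝ, ∑ i, ∑ j,
        a i j * pderiv' d i (heatSemigroup d a (t - u) ⇑φ) x
          * pderiv' d j (heatSemigroup d a (s - u) ⇑ψ) x)
      = gaussPairing d a |t - s| ⇑φ ⇑ψ - gaussPairing d a (t + s) ⇑φ ⇑ψ := by
  obtain ⟨S, hS, rfl⟩ := ha.exists_eq_mul_transpose
  have hcomp (u : ℝ) (φ : (Fin d → ℝ) → ℝ) :
      heatSemigroup d (S * Sᵀ) u φ ∘ mulVecEquiv S hS = heatFlow u (φ ∘ mulVecEquiv S hS) :=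
    funext (heatSemigroup_mulVecEquiv hS u φ)
  simp_rw [integral_eq_abs_det_mul_integral_comp_mulVecEquiv hS
      (fun x ↦ ∑ i, ∑ j, (S * Sᵀ) i j * _ * _), sum_sum_mul_pderiv_mulVecEquiv, hcomp,
    gaussPairing_eq_abs_det_mul hS]
  rw [integral_const_mul, ← mul_sub]
  congr 1
  exact integral_integral_sum_fderiv_heatFlow (EuclideanSpace.basisFun (Fin d) ℝ) hs ht
    (compCLMOfContinuousLinearEquiv ℝ (mulVecEquiv S hS) φ)
    (compCLMOfContinuousLinearEquiv ℝ (mulVecEquiv S hS) ψ)
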